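/- arXiv:1806.00729 — 3 statements merged into one kernel-verified Lean document; each statement's English description precedes it below -/
import Mathlib

section
/- If T and T′ are two standard transitive σ_n-orientations of the same σ_n-partition of K_n, then T′ is a shift of T by a power of σ_n^3: there exists an integer t such that for all distinct vertices a, b, the edge {a,b} is oriented from a to b in T if and only if the edge {a+3t, b+3t} is oriented from a+3t to b+3t in T′. -/
/-- A σ_n-k-partition of K_n: a symmetric labeling of the edges of the complete
graph on `ZMod n` with labels in `ZMod k` such that shifting both endpoints by 1
increases the label by 1 (mod k). -/
def IsSigmaPartition (n k : ℕ) (ℓ : ZMod n → ZMod n → ZMod k) : Prop :=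
  (∀ a b : ZMod n, ℓ a b = ℓ b a) ∧
  (∀ a b : ZMod n, a ≠ b → ℓ (a + 1) (b + 1) = ℓ a b + 1)

/-- `a` precedes `b` in the ordering `τ` of the vertices. -/
def Precedes {n : ℕ} (τ : Fin n ≃ ZMod n) (a b : ZMod n) : Prop :=
  τ.symm a < τ.symm b

/-- σ_n reverses the orientation of the edge {a,b} in the transitive orientation
consistent with `τ`: `a` precedes `b`, but `b+1` precedes `a+1`. -/
def Reverses {n : ℕ} (τ : Fin n ≃ ZMod n) (a b : ZMod n) : Prop :=
  Precedes τ a b ∧ Precedes τ (b + 1) (a + 1)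

/-- The transitive orientation consistent with `τ` is a transitive σ_n-orientation
of the σ_n-k-partition `ℓ`: every edge whose orientation σ_n reverses has
label k-1 (i.e. -1 in `ZMod k`). -/
def IsTransSigmaOrientation (n k : ℕ) (ℓ : ZMod n → ZMod n → ZMod k)
    (τ : Fin n ≃ ZMod n) : Prop :=
  ∀ a b : ZMod n, a ≠ b → Reverses τ a b → ℓ a b = -1

/-- `j` is a local minimum of the ordering `τ`: it precedes both its cyclic
neighbours. -/
def CycLocalMin {n : ℕ} (τ : Fin n ≃ ZMod n) (j : ZMod n) : Prop :=
  Precedes τ j (j - 1) ∧ Precedes τ j (j + 1)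

/-- `j` is a local maximum of the ordering `τ`: both its cyclic neighbours
precede it. -/
def CycLocalMax {n : ℕ} (τ : Fin n ≃ ZMod n) (j : ZMod n) : Prop :=
  Precedes τ (j - 1) j ∧ Precedes τ (j + 1) j

/-- An ordering is bitonic if it has a unique local minimum and a unique local
maximum. -/
def Bitonic {n : ℕ} (τ : Fin n ≃ ZMod n) : Prop :=
  (∃! j, CycLocalMin τ j) ∧ (∃! j, CycLocalMax τ j)

/-- The defining sequence halts at index `i`: `a_{i+1} = a_i`. -/
def Halts (n k : ℕ) (ℓ : ZMod n → ZMod n → ZMod k) (i : ℕ) : Prop :=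
  ℓ 0 ((i + 1 : ℕ) : ZMod n) = ℓ 0 ((i : ℕ) : ZMod n)

/-- The defining sequence steps at index `i`: `a_{i+1} ≡ a_i + 1 (mod k)`. -/
def Steps (n k : ℕ) (ℓ : ZMod n → ZMod n → ZMod k) (i : ℕ) : Prop :=
  ℓ 0 ((i + 1 : ℕ) : ZMod n) = ℓ 0 ((i : ℕ) : ZMod n) + 1

/-- The defining sequence jumps at index `i`: it neither halts nor steps there. -/
def Jumps (n k : ℕ) (ℓ : ZMod n → ZMod n → ZMod k) (i : ℕ) : Prop :=
  ¬ Halts n k ℓ i ∧ ¬ Steps n k ℓ i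

/-- The first `k` vertices of `τ` form the cyclic interval `[l, l+k)`. -/
def Seg {n : ℕ} (τ : Fin n ≃ ZMod n) (l : ZMod n) (k : ℕ) : Prop :=
  ∀ x : ZMod n, (τ.symm x : ℕ) < k ↔ ∃ i : ℕ, i < k ∧ x = l + (i : ZMod n)

lemma natCast_ne {n i j : ℕ} (hi : i < n) (hj : j < n) (h : (i : ZMod n) = (j : ZMod n)) :
    i = j := by
  have := (ZMod.natCast_eq_natCast_iff' i j n).1 h
  rwa [Nat.mod_eq_of_lt hi, Nat.mod_eq_of_lt hj] at this

lemma label_shift {n : ℕ} {ℓ : ZMod n → ZMod n → ZMod 3} (hP : IsSigmaPartition n 3 ℓ)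
    (a b : ZMod n) (hab : a ≠ b) (s : ℕ) :
    ℓ (a + (s : ZMod n)) (b + (s : ZMod n)) = ℓ a b + (s : ZMod 3) := by
  induction s with
  | zero => simp
  | succ s ih =>
    have h := hP.2 (a + (s : ZMod n)) (b + (s : ZMod n)) (by simpa using hab)
    push_cast
    rw [← add_assoc, ← add_assoc, h, ih, add_assoc]

lemma seg_left {n : ℕ} {τ : Fin n ≃ ZMod n} {l : ZMod n} {k : ℕ} (hS : Seg τ l k)
    (hk : k < n) : k ≤ (τ.symm (l - 1) : ℕ) := by
  by_contra h
  obtain ⟨i, hi, hx⟩ := (hS _).1 (not_le.1 h)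
  have h1 : ((i + 1 : ℕ) : ZMod n) = ((0 : ℕ) : ZMod n) := by
    push_cast; linear_combination -hx
  have := natCast_ne (by omega) (by omega) h1
  omega

lemma seg_right {n : ℕ} {τ : Fin n ≃ ZMod n} {l : ZMod n} {k : ℕ} (hS : Seg τ l k)
    (hk : k < n) : k ≤ (τ.symm (l + (k : ZMod n)) : ℕ) := by
  by_contra h
  obtain ⟨i, hi, hx⟩ := (hS _).1 (not_le.1 h)
  have := natCast_ne (by omega) (by omega) (add_left_cancel hx)
  omega

lemma seg_label {n : ℕ} {ℓ : ZMod n → ZMod n → ZMod 3} {τ : Fin n ≃ ZMod n}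
    (hP : IsSigmaPartition n 3 ℓ)
    (hT : IsTransSigmaOrientation n 3 ℓ τ) {l : ZMod n} {k : ℕ} (hS : Seg τ l k)
    (hk0 : 1 ≤ k) (hk : k < n) :
    l - 1 ≠ l + (k : ZMod n) - 1 ∧ ℓ (l - 1) (l + (k : ZMod n) - 1) = -1 := by
  have h1 := seg_left hS hk
  have h2 := seg_right hS hk
  have h3 : (τ.symm l : ℕ) < k := (hS _).2 ⟨0, by omega, by simp⟩
  have h4 : (τ.symm (l + (k : ZMod n) - 1) : ℕ) < k := by
    refine (hS _).2 ⟨k - 1, by omega, ?_⟩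
    rw [Nat.cast_sub hk0]; push_cast; ring
  have hne : l + (k : ZMod n) - 1 ≠ l - 1 := by
    intro h; rw [h] at h4; omega
  refine ⟨hne.symm, ?_⟩
  rw [hP.1]
  refine hT _ _ hne ⟨?_, ?_⟩
  · unfold Precedes; rw [Fin.lt_def]; omega
  · unfold Precedes; rw [sub_add_cancel, sub_add_cancel, Fin.lt_def]; omega

lemma seg_one {n : ℕ} (hn : 0 < n) (τ : Fin n ≃ ZMod n) : Seg τ (τ ⟨0, hn⟩) 1 := by
  intro x
  constructor
  · intro h
    refine ⟨0, by omega, ?_⟩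
    have : τ.symm x = ⟨0, hn⟩ := Fin.ext (by simp; omega)
    rw [← this]; simp
  · rintro ⟨i, hi, rfl⟩
    have : i = 0 := by omega
    subst this
    simp

lemma seg_next {n : ℕ} (hn : 2 ≤ n) {τ : Fin n ≃ ZMod n} (hB : ∃! j, CycLocalMin τ j)
    {l : ZMod n} {k : ℕ} (hS : Seg τ l k) (hk0 : 1 ≤ k) (hk : k < n) :
    (τ ⟨k, hk⟩ = l - 1 ∧ Seg τ (l - 1) (k + 1)) ∨
    (τ ⟨k, hk⟩ = l + (k : ZMod n) ∧ Seg τ l (k + 1)) := by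
  have h10 : (1 : ZMod n) ≠ 0 := by
    intro h
    have := natCast_ne (n := n) (i := 1) (j := 0) (by omega) (by omega) (by simpa using h)
    omega
  have hnot : ¬ CycLocalMin τ (τ ⟨k, hk⟩) := by
    intro h
    have h0 : CycLocalMin τ (τ ⟨0, by omega⟩) := by
      have key : ∀ y, y ≠ τ ⟨0, by omega⟩ → Precedes τ (τ ⟨0, by omega⟩) y := by
        intro y hy
        unfold Precedes
        rw [Equiv.symm_apply_apply, Fin.lt_def]
        by_contra hc
        apply hy
        have : τ.symm y = ⟨0, by omega⟩ := Fin.ext (by simp at hc ⊢; omega)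
        rw [← this]; simp
      exact ⟨key _ (by simpa using h10), key _ (by simpa using h10)⟩
    have := τ.injective (hB.unique h h0)
    simp at this
    omega
  have hmem : ∀ y, ¬ Precedes τ (τ ⟨k, hk⟩) y → y ≠ τ ⟨k, hk⟩ → ∃ i : ℕ, i < k ∧
      y = l + (i : ZMod n) := by
    intro y hy hne
    apply (hS y).1
    unfold Precedes at hy
    rw [Equiv.symm_apply_apply, Fin.lt_def] at hy
    have : (τ.symm y : ℕ) ≠ k := by
      intro h
      apply hne
      have : τ.symm y = ⟨k, hk⟩ := Fin.ext h
      rw [← this]; simp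
    simp at hy
    omega
  have hx : ¬ (∃ i : ℕ, i < k ∧ τ ⟨k, hk⟩ = l + (i : ZMod n)) := by
    intro h
    have := (hS _).2 h
    simp at this
  have hcase : τ ⟨k, hk⟩ = l - 1 ∨ τ ⟨k, hk⟩ = l + (k : ZMod n) := by
    unfold CycLocalMin at hnot
    rw [not_and_or] at hnot
    rcases hnot with h | h
    · obtain ⟨i, hi, he⟩ := hmem _ h (by simpa using h10)
      right
      by_cases hik : i + 1 = k
      · have hkc : (k : ZMod n) = (i : ZMod n) + 1 := by rw [← hik]; push_cast; rfl
        rw [hkc]; linear_combination he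
      · exact absurd ⟨i + 1, by omega, by push_cast; linear_combination he⟩ hx
    · obtain ⟨i, hi, he⟩ := hmem _ h (by simpa using h10)
      left
      rcases i with _ | i
      · push_cast at he; linear_combination he
      · exact absurd ⟨i, by omega, by push_cast at he; linear_combination he⟩ hx
  have hsucc : ∀ x, (τ.symm x : ℕ) < k + 1 ↔ ((τ.symm x : ℕ) < k ∨ x = τ ⟨k, hk⟩) := by
    intro x
    have : x = τ ⟨k, hk⟩ ↔ (τ.symm x : ℕ) = k := by
      rw [← Equiv.symm_apply_eq, Fin.ext_iff]
    rw [this]; omega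
  rcases hcase with h | h
  · refine Or.inl ⟨h, fun x => ?_⟩
    rw [hsucc, hS, h]
    constructor
    · rintro (⟨i, hi, rfl⟩ | rfl)
      · exact ⟨i + 1, by omega, by push_cast; ring⟩
      · exact ⟨0, by omega, by simp⟩
    · rintro ⟨i, hi, rfl⟩
      rcases i with _ | i
      · right; simp
      · left; exact ⟨i, by omega, by push_cast; ring⟩
  · refine Or.inr ⟨h, fun x => ?_⟩
    rw [hsucc, hS, h]
    constructor
    · rintro (⟨i, hi, rfl⟩ | rfl)
      · exact ⟨i, by omega, rfl⟩
      · exact ⟨k, by omega, rfl⟩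
    · rintro ⟨i, hi, rfl⟩
      by_cases hik : i = k
      · right; rw [hik]
      · left; exact ⟨i, by omega, rfl⟩

/-- Two standard transitive σ_n-orientations of the same
σ_n-partition differ by a shift by a power of σ_n^3. -/
theorem stmt_3 (n : ℕ) (hn : 0 < n)
    (ℓ : ZMod n → ZMod n → ZMod 3) (hP : IsSigmaPartition n 3 ℓ)
    (τ τ' : Fin n ≃ ZMod n)
    (hT : IsTransSigmaOrientation n 3 ℓ τ) (hB : Bitonic τ)
    (hT' : IsTransSigmaOrientation n 3 ℓ τ') (hB' : Bitonic τ') :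
    ∃ t : ℤ, ∀ a b : ZMod n, a ≠ b →
      (Precedes τ a b ↔
        Precedes τ' (a + ((3 * t : ℤ) : ZMod n)) (b + ((3 * t : ℤ) : ZMod n))) := by
  by_cases hn2 : n < 2
  · have : n = 1 := by omega
    subst this
    exact ⟨0, fun a b hab => absurd (Subsingleton.elim a b) hab⟩
  have hn2 : 2 ≤ n := by omega
  have : NeZero n := ⟨by omega⟩
  obtain ⟨c, hc⟩ : ∃ c : ZMod n, c = τ' ⟨0, hn⟩ - τ ⟨0, hn⟩ := ⟨_, rfl⟩
  have hc0 : τ' ⟨0, hn⟩ = τ ⟨0, hn⟩ + c := by rw [hc]; ring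
  have hcv : ((c.val : ℕ) : ZMod n) = c := ZMod.natCast_zmod_val c
  have hs1 := seg_one hn τ
  have hs1' := seg_one hn τ'
  rw [hc0] at hs1'
  have hshift : ∀ a b : ZMod n, a ≠ b → ℓ (a + c) (b + c) = ℓ a b + ((c.val : ℕ) : ZMod 3) := by
    intro a b hab
    have := label_shift hP a b hab c.val
    rwa [hcv] at this
  have hc3 : ((c.val : ℕ) : ZMod 3) = 0 := by
    obtain ⟨hne, h1⟩ := seg_label hP hT hs1 le_rfl (by omega)
    obtain ⟨-, h2⟩ := seg_label hP hT' hs1' le_rfl (by omega)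
    have h3 := hshift _ _ hne
    rw [h1] at h3
    have e1 : τ ⟨0, hn⟩ - 1 + c = τ ⟨0, hn⟩ + c - 1 := by ring
    have e2 : τ ⟨0, hn⟩ + ((1 : ℕ) : ZMod n) - 1 + c = τ ⟨0, hn⟩ + c + ((1 : ℕ) : ZMod n) - 1 := by
      ring
    rw [e1, e2, h2] at h3
    linear_combination -h3
  have hshift0 : ∀ a b : ZMod n, a ≠ b → ℓ (a + c) (b + c) = ℓ a b := by
    intro a b hab; rw [hshift a b hab, hc3, add_zero]
  have h30 : (-1 : ZMod 3) ≠ -1 + 1 := by decide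
  have main : ∀ k : ℕ, 1 ≤ k → k ≤ n → ∃ l : ZMod n, Seg τ l k ∧ Seg τ' (l + c) k ∧
      ∀ i (hi : i < n), i < k → τ' ⟨i, hi⟩ = τ ⟨i, hi⟩ + c := by
    intro k hk1
    induction k, hk1 using Nat.le_induction with
    | base =>
      intro _
      refine ⟨_, hs1, hs1', fun i hi hi1 => ?_⟩
      have : i = 0 := by omega
      subst this
      exact hc0
    | succ k hk1 ih =>
      intro hkn
      obtain ⟨l, hS, hS', heq⟩ := ih (by omega)
      have hk : k < n := by omega
      have ext : τ' ⟨k, hk⟩ = τ ⟨k, hk⟩ + c →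
          ∀ i (hi : i < n), i < k + 1 → τ' ⟨i, hi⟩ = τ ⟨i, hi⟩ + c := by
        intro h i hi hik
        by_cases hik' : i = k
        · subst hik'; exact h
        · exact heq i hi (by omega)
      have wrap : k + 1 = n → (k : ZMod n) + 1 = 0 := by
        intro h
        have : ((k + 1 : ℕ) : ZMod n) = 0 := by rw [h]; simp
        simpa using this
      have full : k + 1 = n → ∀ (ρ : Fin n ≃ ZMod n) (u v : ZMod n), Seg ρ u (k + 1) →
          Seg ρ v (k + 1) := by
        intro h ρ u v _ x
        refine ⟨fun _ => ⟨(x - v).val, ?_, ?_⟩, fun _ => ?_⟩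
        · rw [h]; exact ZMod.val_lt _
        · rw [ZMod.natCast_zmod_val]; ring
        · rw [h]; exact (ρ.symm x).2
      rcases seg_next hn2 hB.1 hS hk1 hk with ⟨h1, hN⟩ | ⟨h1, hN⟩ <;>
        rcases seg_next hn2 hB'.1 hS' hk1 hk with ⟨h2, hN'⟩ | ⟨h2, hN'⟩
      · refine ⟨l - 1, hN, ?_, ext ?_⟩
        · have e : l - 1 + c = l + c - 1 := by ring
          rwa [e]
        · rw [h1, h2]; ring
      · by_cases hlast : k + 1 = n
        · refine ⟨l - 1, hN, full hlast _ _ _ hN', ext ?_⟩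
          rw [h1, h2]; linear_combination wrap hlast
        · exfalso
          obtain ⟨hne, h3⟩ := seg_label hP hT hN (by omega) (by omega)
          obtain ⟨-, h4⟩ := seg_label hP hT' hN' (by omega) (by omega)
          have h5 := hP.2 _ _ hne
          have h6 := hshift0 (l - 1 - 1 + 1) (l - 1 + ((k + 1 : ℕ) : ZMod n) - 1 + 1)
            (by simpa using hne)
          have e1 : l - 1 - 1 + 1 + c = l + c - 1 := by ring
          have e2 : l - 1 + ((k + 1 : ℕ) : ZMod n) - 1 + 1 + c
              = l + c + ((k + 1 : ℕ) : ZMod n) - 1 := by ring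
          rw [h5, h3, e1, e2, h4] at h6
          exact h30 h6
      · by_cases hlast : k + 1 = n
        · refine ⟨l, hN, full hlast _ _ _ hN', ext ?_⟩
          rw [h1, h2]; linear_combination - wrap hlast
        · exfalso
          obtain ⟨hne, h3⟩ := seg_label hP hT hN (by omega) (by omega)
          obtain ⟨hne', h4⟩ := seg_label hP hT' hN' (by omega) (by omega)
          have h5 := hP.2 _ _ hne'
          have h6 := hshift0 _ _ hne
          have e1 : l + c - 1 - 1 + 1 = l - 1 + c := by ring
          have e2 : l + c - 1 + ((k + 1 : ℕ) : ZMod n) - 1 + 1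
              = l + ((k + 1 : ℕ) : ZMod n) - 1 + c := by ring
          rw [e1, e2, h6, h3, h4] at h5
          exact h30 h5
      · refine ⟨l, hN, hN', ext ?_⟩
        rw [h1, h2]; ring
  obtain ⟨-, -, -, hall⟩ := main n (by omega) le_rfl
  obtain ⟨t, ht⟩ : 3 ∣ c.val := (ZMod.natCast_eq_zero_iff _ _).1 hc3
  have hct : ((3 * (t : ℤ) : ℤ) : ZMod n) = c := by
    rw [← hcv, ht]; push_cast; ring
  have hsymm : ∀ a, τ'.symm (a + c) = τ.symm a := by
    intro a
    rw [Equiv.symm_apply_eq]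
    have := hall (τ.symm a) (τ.symm a).2 (τ.symm a).2
    simpa using this.symm
  refine ⟨t, fun a b _ => ?_⟩
  rw [hct]
  unfold Precedes
  rw [hsymm, hsymm]
end

section
/- Let k > 1. If a σ_n-k-partition of K_n admits a transitive σ_n-orientation, then its dual σ_n-k-partition also admits a transitive σ_n-orientation. -/
theorem shift_nat {n k : ℕ} {ℓ : ZMod n → ZMod n → ZMod k} (hP : IsSigmaPartition n k ℓ)
    (m : ℕ) (a b : ZMod n) (h : a ≠ b) : ℓ (a + m) (b + m) = ℓ a b + m := by
  induction m with
  | zero => simp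
  | succ m ih =>
    have := hP.2 (a + m) (b + m) (fun e => h (add_right_cancel e))
    push_cast
    rw [← add_assoc, ← add_assoc, this, ih, add_assoc]

theorem dual_aux {n k : ℕ} {ℓ ℓ' : ZMod n → ZMod n → ZMod k}
    (hP : IsSigmaPartition n k ℓ) (hP' : IsSigmaPartition n k ℓ')
    (i m : ℕ) (hi : (i : ZMod n) ≠ 0)
    (h : ℓ' 0 (i : ZMod n) = (i : ZMod k) - 1 - ℓ 0 (i : ZMod n)) :
    ℓ' (m : ZMod n) (m + i) = -1 - ℓ (-(m : ZMod n)) (-(m + i : ZMod n)) := by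
  have h1 := shift_nat hP' m 0 i (Ne.symm hi)
  have h2 := shift_nat hP (m + i) (-(m : ZMod n)) (-(m + i : ZMod n)) (by
    intro e
    apply hi
    have e' := neg_injective e
    simpa using e')
  have e1 : (-(m : ZMod n)) + ((m + i : ℕ) : ZMod n) = i := by push_cast; ring
  have e2 : (-(m + i : ZMod n)) + ((m + i : ℕ) : ZMod n) = 0 := by push_cast; ring
  rw [e1, e2, hP.1] at h2
  rw [zero_add, add_comm (i : ZMod n)] at h1
  rw [h1, h, h2]
  push_cast
  ring

theorem dual_all {n k : ℕ} [NeZero n] {ℓ ℓ' : ZMod n → ZMod n → ZMod k}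
    (hP : IsSigmaPartition n k ℓ) (hP' : IsSigmaPartition n k ℓ')
    (hdual : ∀ i : ℕ, 1 ≤ i → i ≤ n / 2 →
      ℓ' 0 ((i : ℕ) : ZMod n) = (i : ZMod k) - 1 - ℓ 0 ((i : ℕ) : ZMod n))
    (a b : ZMod n) (hab : a ≠ b) : ℓ' a b = -1 - ℓ (-a) (-b) := by
  have key : ∀ a b : ZMod n, a ≠ b → (b - a).val ≤ n / 2 →
      ℓ' a b = -1 - ℓ (-a) (-b) := by
    intro a b hab hle
    have hne : b - a ≠ 0 := sub_ne_zero.mpr hab.symm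
    have hc : (((b - a).val : ℕ) : ZMod n) = b - a := ZMod.natCast_zmod_val _
    have hpos : 1 ≤ (b - a).val := by
      have : (b - a).val ≠ 0 := fun h => hne ((ZMod.val_eq_zero _).mp h)
      omega
    have := dual_aux hP hP' (b - a).val a.val (by rw [hc]; exact hne) (hdual _ hpos hle)
    rw [hc, ZMod.natCast_zmod_val, add_sub_cancel] at this
    exact this
  by_cases h : (b - a).val ≤ n / 2
  · exact key a b hab h
  · rw [hP'.1, hP.1]
    apply key b a hab.symm
    have hne : b - a ≠ 0 := sub_ne_zero.mpr hab.symm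
    haveI : NeZero (b - a) := ⟨hne⟩
    rw [← neg_sub b a, ZMod.val_neg_of_ne_zero]
    omega

/-- If a σ_n-k-partition admits a transitive σ_n-orientation,
then so does its dual (the σ_n-k-partition whose defining sequence is
b_i ≡ i - 1 - a_i (mod k)). -/
theorem stmt_13 (n k : ℕ) (hk : 1 < k)
    (ℓ ℓ' : ZMod n → ZMod n → ZMod k)
    (hP : IsSigmaPartition n k ℓ) (hP' : IsSigmaPartition n k ℓ')
    (hdual : ∀ i : ℕ, 1 ≤ i → i ≤ n / 2 →
      ℓ' 0 ((i : ℕ) : ZMod n) = (i : ZMod k) - 1 - ℓ 0 ((i : ℕ) : ZMod n))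
    (hT : ∃ τ : Fin n ≃ ZMod n, IsTransSigmaOrientation n k ℓ τ) :
    ∃ τ : Fin n ≃ ZMod n, IsTransSigmaOrientation n k ℓ' τ := by
  obtain ⟨τ, hτ⟩ := hT
  rcases Nat.eq_zero_or_pos n with h0 | h0
  · subst h0
    exact (τ.symm 0).elim0
  haveI : NeZero n := ⟨h0.ne'⟩
  refine ⟨τ.trans (Equiv.neg _), ?_⟩
  intro a b hab hr
  obtain ⟨h1, h2⟩ := hr
  have h1' : τ.symm (-a) < τ.symm (-b) := h1
  have h2' : τ.symm (-(b + 1)) < τ.symm (-(a + 1)) := h2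
  have hne : -(b + 1) ≠ -(a + 1) := fun e => hab (add_right_cancel (neg_injective e)).symm
  have eb : -(b + 1) + 1 = -b := by ring
  have ea : -(a + 1) + 1 = -a := by ring
  have h3 := hτ (-(b + 1)) (-(a + 1)) hne ⟨h2', by unfold Precedes; rw [ea, eb]; exact h1'⟩
  have h4 := hP.2 _ _ hne
  rw [h3, ea, eb] at h4
  rw [dual_all hP hP' hdual a b hab, hP.1, h4]
  ring
end

section
/- Let k > 1 and suppose a σ_n-k-partition P of K_n admits a transitive σ_n-orientation. If the defining sequence of P jumps at an index i, then either there is an index j < i where the sequence halts and at least k−1 distinct indices j′ < i where it steps, or there is an index j < i where it steps and at least k−1 distinct indices j′ < i where it halts. -/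
/-- The increasing / decreasing runs around a local maximum at 0. -/
lemma runs (k : ℕ) (P : ℤ → ℕ) (N : ℕ) (hN : 1 ≤ N) (a : ℕ → ZMod k)
    (hne : ∀ (x : ℤ) (j : ℕ), 1 ≤ j → j ≤ N → P x ≠ P (x + j))
    (hf : ∀ (x : ℤ) (j : ℕ), 1 ≤ j → j ≤ N → (x : ZMod k) + a j ≠ 0 →
      (P (x - 1) < P (x - 1 + j) ↔ P x < P (x + j)))
    (h1 : a 1 = 0) (hl : P (-1) < P 0) (hr : P 1 < P 0) (m : ℕ) (hm : m < k) :
    P (-m - 1) < P (-m) ∧ P (m + 1) < P m := by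
  induction m with
  | zero => simpa using ⟨hl, hr⟩
  | succ m ih =>
    obtain ⟨ihl, ihr⟩ := ih (by omega)
    have hz : ((m + 1 : ℕ) : ZMod k) ≠ 0 := by
      intro h
      rw [ZMod.natCast_eq_zero_iff] at h
      have := Nat.le_of_dvd (by omega) h
      omega
    constructor
    · have := (hf (-(m + 1 : ℕ)) 1 le_rfl hN (by
        rw [h1, add_zero, Int.cast_neg, Int.cast_natCast]; exact neg_ne_zero.2 hz)).2 (by
          convert ihl using 2 <;> push_cast <;> ring)
      convert this using 2; push_cast; ring
    · have h2 := (hf ((m + 1 : ℕ)) 1 le_rfl hN (by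
        rw [h1, add_zero, Int.cast_natCast]; exact hz))
      have h3 := hne ((m + 1 : ℕ) : ℤ) 1 le_rfl hN
      push_cast at h2 h3 ⊢
      rw [add_sub_cancel_right] at h2
      have := h2.not.1 (by omega)
      omega

/-- All halts before the last index: no jump. -/
lemma all_halts (k : ℕ) (hk : 1 < k) (P : ℤ → ℕ) (i : ℕ) (hi : 1 ≤ i) (a : ℕ → ZMod k)
    (hne : ∀ (x : ℤ) (j : ℕ), 1 ≤ j → j ≤ i + 1 → P x ≠ P (x + j))
    (hf : ∀ (x : ℤ) (j : ℕ), 1 ≤ j → j ≤ i + 1 → (x : ZMod k) + a j ≠ 0 →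
      (P (x - 1) < P (x - 1 + j) ↔ P x < P (x + j)))
    (h1 : a 1 = 0) (hl : P (-1) < P 0) (hr : P 1 < P 0)
    (hh : ∀ j, 1 ≤ j → j ≤ i → a j = 0) (hc0 : a (i + 1) ≠ 0) (hc1 : a (i + 1) ≠ 1) :
    False := by
  have : Fact (1 < k) := ⟨hk⟩
  have r0 := runs k P (i + 1) (by omega) a hne hf h1 hl hr 1 hk
  norm_num at r0
  obtain ⟨rl, rr⟩ := r0
  have key : ∀ j : ℕ, 1 ≤ j → j ≤ i →
      P (-1) < P (-1 + j) ∧ P (1 + j) < P 1 := by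
    intro j hj
    induction j, hj using Nat.le_induction with
    | base =>
      intro _
      norm_num
      exact ⟨hl, rr⟩
    | succ j hj ih =>
      intro hji
      obtain ⟨il, ir⟩ := ih (by omega)
      have e1 := hf (-1) (j + 1) (by omega) (by omega) (by rw [hh _ (by omega) hji]; simp)
      have e2 := hf 1 (j + 1) (by omega) (by omega) (by rw [hh _ (by omega) hji]; simp)
      have e3 := hne 1 (j + 1) (by omega) (by omega)
      have t1 : (-1 - 1 + ((j + 1 : ℕ) : ℤ)) = -1 + j := by push_cast; ring
      have t2 : (1 - 1 + ((j + 1 : ℕ) : ℤ)) = 1 + j := by push_cast; ring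
      rw [t1] at e1
      rw [t2] at e2
      norm_num at e1 e2 e3 ⊢
      omega
  obtain ⟨kl, kr⟩ := key i hi le_rfl
  have e1 := hf (-1) (i + 1) (by omega) (by omega) (by
    intro h; apply hc1; push_cast at h; linear_combination h)
  have e2 := hf 0 (i + 1) (by omega) (by omega) (by simpa using hc0)
  have t1 : (-1 - 1 + ((i + 1 : ℕ) : ℤ)) = -1 + i := by push_cast; ring
  have t2 : (0 + ((i + 1 : ℕ) : ℤ)) = 1 + i := by push_cast; ring
  rw [t1] at e1
  rw [t2] at e2
  have t3 : (-1 + ((i + 1 : ℕ) : ℤ)) = (0 - 1 + ((i + 1 : ℕ) : ℤ)) := by push_cast; ring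
  rw [t3] at e1
  norm_num at e1 e2
  omega

/-- All steps before the last index: no jump (reflection of the previous lemma). -/
lemma all_steps (k : ℕ) (hk : 1 < k) (P : ℤ → ℕ) (i : ℕ) (hi : 1 ≤ i) (a : ℕ → ZMod k)
    (hne : ∀ (x : ℤ) (j : ℕ), 1 ≤ j → j ≤ i + 1 → P x ≠ P (x + j))
    (hf : ∀ (x : ℤ) (j : ℕ), 1 ≤ j → j ≤ i + 1 → (x : ZMod k) + a j ≠ 0 →
      (P (x - 1) < P (x - 1 + j) ↔ P x < P (x + j)))
    (h1 : a 1 = 0) (hl : P (-1) < P 0) (hr : P 1 < P 0)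
    (hh : ∀ j, 1 ≤ j → j ≤ i → a j = (j : ZMod k) - 1) (hc0 : a (i + 1) ≠ (i : ZMod k) - 1)
    (hc1 : a (i + 1) ≠ (i : ZMod k)) :
    False := by
  refine all_halts k hk (fun x => P (-x)) i hi (fun j => (j : ZMod k) - 1 - a j) ?_ ?_ ?_
    (by simpa using hr) (by simpa using hl) ?_ ?_ ?_
  · intro x j hj hj'
    have := hne (-(x + j)) j hj hj'
    rw [show -(x + (j : ℤ)) + j = -x by ring] at this
    exact this.symm
  · intro x j hj hj' h
    have e := hf (-(x + j) + 1) j hj hj' (by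
      intro h'; apply h; push_cast at h'; linear_combination - h')
    have n1 := hne (-(x + j) + 1) j hj hj'
    have n2 := hne (-(x + j)) j hj hj'
    rw [show -(x + (j : ℤ)) + 1 - 1 + j = -x by ring,
      show -(x + (j : ℤ)) + 1 - 1 = -(x + j) by ring,
      show -(x + (j : ℤ)) + 1 + j = -(x - 1) by ring,
      show -(x + (j : ℤ)) + 1 = -(x - 1 + j) by ring] at e
    rw [show -(x + (j : ℤ)) + 1 + j = -(x - 1) by ring,
      show -(x + (j : ℤ)) + 1 = -(x - 1 + j) by ring] at n1
    rw [show -(x + (j : ℤ)) + j = -x by ring] at n2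
    show P (-(x - 1)) < P (-(x - 1 + j)) ↔ P (-x) < P (-(x + j))
    omega
  · simp [h1]
  · intro j hj hj'
    simp [hh j hj hj']
  · intro h
    apply hc1
    push_cast at h
    linear_combination -h
  · intro h
    apply hc0
    push_cast at h
    linear_combination -h

/-- Few halts and few steps before the last index: no jump. -/
lemma few_both (k : ℕ) (hk : 1 < k) (P : ℤ → ℕ) (i : ℕ) (hi : 1 ≤ i) (a : ℕ → ZMod k)
    (hne : ∀ (x : ℤ) (j : ℕ), 1 ≤ j → j ≤ i + 1 → P x ≠ P (x + j))
    (hf : ∀ (x : ℤ) (j : ℕ), 1 ≤ j → j ≤ i + 1 → (x : ZMod k) + a j ≠ 0 →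
      (P (x - 1) < P (x - 1 + j) ↔ P x < P (x + j)))
    (h1 : a 1 = 0) (hl : P (-1) < P 0) (hr : P 1 < P 0)
    (s h : ℕ → ℕ) (hs1 : s 1 = 0) (hh1 : h 1 = 0)
    (hsh : ∀ j, 1 ≤ j → j < i →
      (a (j + 1) = a j ∧ s (j + 1) = s j ∧ h (j + 1) = h j + 1) ∨
      (a (j + 1) = a j + 1 ∧ s (j + 1) = s j + 1 ∧ h (j + 1) = h j))
    (hsk : ∀ j, 1 ≤ j → j ≤ i → s j + 2 ≤ k) (hhk : ∀ j, 1 ≤ j → j ≤ i → h j + 2 ≤ k)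
    (hc0 : a (i + 1) ≠ a i) (hc1 : a (i + 1) ≠ a i + 1) : False := by
  have : Fact (1 < k) := ⟨hk⟩
  have rn := runs k P (i + 1) (by omega) a hne hf h1 hl hr
  have key : ∀ j : ℕ, 1 ≤ j → j ≤ i → a j = (s j : ZMod k) ∧ j = 1 + s j + h j ∧
      P (-(s j) - 1) < P (h j) ∧ P (h j + 1) < P (-(s j)) := by
    intro j hj
    induction j, hj using Nat.le_induction with
    | base =>
      intro _
      simp only [hs1, hh1, h1]
      simpa using ⟨hl, hr⟩
    | succ j hj ih =>
      intro hji
      obtain ⟨ia, ij, il, ir⟩ := ih (by omega)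
      have q1 := hsk j hj (by omega)
      have q2 := hhk j hj (by omega)
      have r1 := (rn (s j + 1) (by omega)).1
      have r2 := (rn (h j + 1) (by omega)).2
      have hjz : (j : ℤ) = 1 + s j + h j := by exact_mod_cast ij
      rcases hsh j hj (by omega) with ⟨ea, es, eh⟩ | ⟨ea, es, eh⟩
      · have e := hf (-(s j) - 1) (j + 1) (by omega) (by omega) (by
          rw [ea, ia]; push_cast
          intro hz; exact one_ne_zero (α := ZMod k) (by linear_combination -hz))
        rw [es, eh, ea]
        refine ⟨ia, by omega, ?_, ?_⟩
        · rw [show -(s j : ℤ) - 1 + ((j + 1 : ℕ) : ℤ) = ((h j + 1 : ℕ) : ℤ) by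
              push_cast; rw [hjz]; ring,
            show -(s j : ℤ) - 1 - 1 + ((j + 1 : ℕ) : ℤ) = h j by
              push_cast; rw [hjz]; ring] at e
          apply e.1
          refine lt_trans ?_ il
          rw [show -((s j + 1 : ℕ) : ℤ) = -(s j) - 1 by push_cast; ring] at r1
          exact r1
        · refine lt_trans r2 ?_
          rw [Nat.cast_add, Nat.cast_one]
          exact ir
      · have e := hf (-(s j)) (j + 1) (by omega) (by omega) (by
          rw [ea, ia]; push_cast
          intro hz; exact one_ne_zero (α := ZMod k) (by linear_combination hz))
        have e' := hne (-(s j) - 1) (j + 1) (by omega) (by omega)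
        rw [es, eh, ea]
        refine ⟨by rw [ia]; push_cast; rfl, by omega, ?_, ?_⟩
        · refine lt_trans r1 ?_
          rw [show -((s j + 1 : ℕ) : ℤ) = -(s j) - 1 by push_cast; ring]
          exact il
        · rw [show -(s j : ℤ) + ((j + 1 : ℕ) : ℤ) = ((h j + 1 : ℕ) : ℤ) + 1 by
              push_cast; rw [hjz]; ring,
            show -(s j : ℤ) - 1 + ((j + 1 : ℕ) : ℤ) = h j + 1 by
              push_cast; rw [hjz]; ring] at e
          rw [show -(s j : ℤ) - 1 + ((j + 1 : ℕ) : ℤ) = h j + 1 by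
              push_cast; rw [hjz]; ring] at e'
          push_cast at *
          rw [show -((s j : ℤ) + 1) = -(s j) - 1 by ring]
          omega
  obtain ⟨ia, ij, il, ir⟩ := key i hi le_rfl
  have q1 := hsk i hi (by omega)
  have q2 := hhk i hi (by omega)
  have r1 := (rn (s i + 1) (by omega)).1
  have r2 := (rn (h i + 1) (by omega)).2
  have hjz : (i : ℤ) = 1 + s i + h i := by exact_mod_cast ij
  have e1 := hf (-(s i) - 1) (i + 1) (by omega) (by omega) (by
    intro h; apply hc1; rw [ia]; push_cast at h; linear_combination h)
  have e2 := hf (-(s i)) (i + 1) (by omega) (by omega) (by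
    intro h; apply hc0; rw [ia]; push_cast at h; linear_combination h)
  have e3 := e1.trans e2
  rw [show -(s i : ℤ) + ((i + 1 : ℕ) : ℤ) = ((h i + 1 : ℕ) : ℤ) + 1 by
              push_cast; rw [hjz]; ring,
            show -(s i : ℤ) - 1 - 1 + ((i + 1 : ℕ) : ℤ) = h i by
              push_cast; rw [hjz]; ring] at e3
  push_cast at *
  rw [show -((s i : ℤ) + 1) = -(s i) - 1 by ring] at r1
  omega

/-- Passing to the abstract setting. -/
lemma to_abstract (n k : ℕ)
    (ℓ : ZMod n → ZMod n → ZMod k) (hP : IsSigmaPartition n k ℓ)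
    (hT : ∃ τ : Fin n ≃ ZMod n, IsTransSigmaOrientation n k ℓ τ)
    (i : ℕ) (hi1 : 1 ≤ i) (hi2 : i < n / 2) :
    ∃ (P : ℤ → ℕ) (c : ZMod k),
    (∀ (x : ℤ) (j : ℕ), 1 ≤ j → j ≤ i + 1 → P x ≠ P (x + j)) ∧
    (∀ (x : ℤ) (j : ℕ), 1 ≤ j → j ≤ i + 1 → (x : ZMod k) + (ℓ 0 (j : ZMod n) + c) ≠ 0 →
      (P (x - 1) < P (x - 1 + j) ↔ P x < P (x + j))) ∧
    ℓ 0 ((1 : ℕ) : ZMod n) + c = 0 ∧ P (-1) < P 0 ∧ P 1 < P 0 := by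
  obtain ⟨τ, hτ⟩ := hT
  obtain ⟨hsym, hstep⟩ := hP
  obtain ⟨x0, hx0⟩ := ZMod.intCast_surjective (τ ⟨n - 1, by omega⟩)
  have hj0 : ∀ j : ℕ, 1 ≤ j → j ≤ i + 1 → (j : ZMod n) ≠ 0 := by
    intro j hj hj' h
    rw [ZMod.natCast_eq_zero_iff] at h
    have := Nat.le_of_dvd (by omega) h
    omega
  have hlab : ∀ (j : ℕ), 1 ≤ j → j ≤ i + 1 → ∀ x : ℤ,
      ℓ (x : ZMod n) ((x : ZMod n) + j) = ℓ 0 (j : ZMod n) + (x : ZMod k) := by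
    intro j hj hj' x
    have hne' : ∀ y : ZMod n, y ≠ y + j := by
      intro y h
      exact hj0 j hj hj' (by simpa using h)
    induction x using Int.induction_on with
    | zero => simp
    | succ m ih =>
      have := hstep (m : ZMod n) (m + j) (hne' _)
      push_cast at ih ⊢
      rw [show (m : ZMod n) + 1 + j = m + j + 1 by ring, this, ih]
      ring
    | pred m ih =>
      have := hstep (-(m : ZMod n) - 1) (-(m : ZMod n) - 1 + j) (hne' _)
      push_cast at ih ⊢
      rw [show -(m : ZMod n) - 1 + 1 = -m by ring,
        show -(m : ZMod n) - 1 + j + 1 = -m + j by ring, ih] at this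
      linear_combination -this
  have hne : ∀ (x : ℤ) (j : ℕ), 1 ≤ j → j ≤ i + 1 →
      (τ.symm ((x + x0 : ℤ) : ZMod n)).val ≠ (τ.symm ((x + j + x0 : ℤ) : ZMod n)).val := by
    intro x j hj hj' h
    have := τ.symm.injective (Fin.ext h)
    apply hj0 j hj hj'
    push_cast at this
    linear_combination -this
  have hf : ∀ (x : ℤ) (j : ℕ), 1 ≤ j → j ≤ i + 1 →
      (x : ZMod k) + (ℓ 0 (j : ZMod n) + (x0 : ZMod k)) ≠ 0 →
      ((τ.symm ((x - 1 + x0 : ℤ) : ZMod n)).val < (τ.symm ((x - 1 + j + x0 : ℤ) : ZMod n)).val ↔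
       (τ.symm ((x + x0 : ℤ) : ZMod n)).val < (τ.symm ((x + j + x0 : ℤ) : ZMod n)).val) := by
    intro x j hj hj' h
    have n1 := hne (x - 1) j hj hj'
    have n2 := hne x j hj hj'
    have hl := hlab j hj hj' (x - 1 + x0)
    have hed : ((x - 1 + x0 : ℤ) : ZMod n) ≠ ((x - 1 + j + x0 : ℤ) : ZMod n) := by
      intro h'
      exact n1 (by rw [h'])
    have hl' : ℓ ((x - 1 + x0 : ℤ) : ZMod n) ((x - 1 + j + x0 : ℤ) : ZMod n) ≠ -1 := by
      rw [show ((x - 1 + j + x0 : ℤ) : ZMod n) = ((x - 1 + x0 : ℤ) : ZMod n) + j by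
        push_cast; ring, hl]
      intro h'
      apply h
      push_cast at h'
      linear_combination h'
    have A : ¬ Reverses τ _ _ := fun hr => hl' (hτ _ _ hed hr)
    have B : ¬ Reverses τ _ _ := fun hr => hl' ((hsym _ _).trans (hτ _ _ hed.symm hr))
    unfold Reverses Precedes at A B
    rw [show ((x - 1 + x0 : ℤ) : ZMod n) + 1 = ((x + x0 : ℤ) : ZMod n) by push_cast; ring,
      show ((x - 1 + j + x0 : ℤ) : ZMod n) + 1 = ((x + j + x0 : ℤ) : ZMod n) by
        push_cast; ring] at A B
    rw [Fin.lt_def, Fin.lt_def] at A B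
    omega
  have hmax : ∀ y : ℤ, (τ.symm ((y : ℤ) : ZMod n)).val ≤ (τ.symm ((0 + x0 : ℤ) : ZMod n)).val := by
    intro y
    rw [zero_add, hx0, Equiv.symm_apply_apply]
    have := (τ.symm ((y : ℤ) : ZMod n)).isLt
    show _ ≤ n - 1
    omega
  have hl : (τ.symm ((-1 + x0 : ℤ) : ZMod n)).val < (τ.symm ((0 + x0 : ℤ) : ZMod n)).val := by
    have a1 := hmax (-1 + x0)
    have a2 := hne (-1) 1 le_rfl (by omega)
    norm_num at a1 a2 ⊢
    omega
  have hr : (τ.symm ((1 + x0 : ℤ) : ZMod n)).val < (τ.symm ((0 + x0 : ℤ) : ZMod n)).val := by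
    have a1 := hmax (1 + x0)
    have a2 := hne 0 1 le_rfl (by omega)
    norm_num at a1 a2 ⊢
    omega
  refine ⟨fun x => (τ.symm ((x + x0 : ℤ) : ZMod n)).val, (x0 : ZMod k), hne, hf, ?_, hl, hr⟩
  by_contra hcon
  have := hf 0 1 le_rfl (by omega) (by simpa using hcon)
  norm_num at this hl hr
  omega

/-- If a σ_n-k-partition admitting a transitive σ_n-orientation
jumps at an index i, then before i there is a halt together with at least k-1
distinct steps, or a step together with at least k-1 distinct halts. -/
theorem stmt_14 (n k : ℕ) (hk : 1 < k)
    (ℓ : ZMod n → ZMod n → ZMod k) (hP : IsSigmaPartition n k ℓ)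
    (hT : ∃ τ : Fin n ≃ ZMod n, IsTransSigmaOrientation n k ℓ τ)
    (i : ℕ) (hi1 : 1 ≤ i) (hi2 : i < n / 2) (hjump : Jumps n k ℓ i) :
    ((∃ j : ℕ, 1 ≤ j ∧ j < i ∧ Halts n k ℓ j) ∧
      ∃ S : Finset ℕ, k - 1 ≤ S.card ∧ ∀ j' ∈ S, 1 ≤ j' ∧ j' < i ∧ Steps n k ℓ j') ∨
    ((∃ j : ℕ, 1 ≤ j ∧ j < i ∧ Steps n k ℓ j) ∧
      ∃ S : Finset ℕ, k - 1 ≤ S.card ∧ ∀ j' ∈ S, 1 ≤ j' ∧ j' < i ∧ Halts n k ℓ j') := by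
  induction i using Nat.strong_induction_on with
  | _ i IH =>
  by_cases hprev : ∃ j, 1 ≤ j ∧ j < i ∧ Jumps n k ℓ j
  · obtain ⟨j, hj1, hji, hj⟩ := hprev
    rcases IH j hji hj1 (by omega) hj with ⟨⟨u, hu1, hu2, hu⟩, S, hS, hS'⟩ |
      ⟨⟨u, hu1, hu2, hu⟩, S, hS, hS'⟩
    · exact Or.inl ⟨⟨u, hu1, by omega, hu⟩, S, hS, fun v hv =>
        ⟨(hS' v hv).1, (hS' v hv).2.1.trans hji, (hS' v hv).2.2⟩⟩
    · exact Or.inr ⟨⟨u, hu1, by omega, hu⟩, S, hS, fun v hv =>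
        ⟨(hS' v hv).1, (hS' v hv).2.1.trans hji, (hS' v hv).2.2⟩⟩
  clear IH
  have hno : ∀ j, 1 ≤ j → j < i → Halts n k ℓ j ∨ Steps n k ℓ j := by
    intro j h1 h2
    by_contra hcon
    exact hprev ⟨j, h1, h2, not_or.1 hcon⟩
  have : Fact (1 < k) := ⟨hk⟩
  obtain ⟨P, c, hne, hf, h1, hl, hr⟩ := to_abstract n k ℓ hP hT i hi1 hi2
  obtain ⟨hj1, hj2⟩ := hjump
  unfold Halts at hj1
  unfold Steps at hj2
  by_cases cs : ∃ j, 1 ≤ j ∧ j < i ∧ Steps n k ℓ j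
  swap
  · exfalso
    refine all_halts k hk P i hi1 (fun j => ℓ 0 (j : ZMod n) + c) hne hf h1 hl hr ?_ ?_ ?_
    all_goals
      have H : ∀ j, 1 ≤ j → j ≤ i → ℓ 0 (j : ZMod n) + c = 0 := by
        intro j hj
        induction j, hj using Nat.le_induction with
        | base => intro _; exact h1
        | succ j hj ih =>
          intro hji
          rcases hno j hj (by omega) with h | h
          · unfold Halts at h
            rw [h, ih (by omega)]
          · exact absurd ⟨j, hj, by omega, h⟩ cs
      have Hi := H i hi1 le_rfl
    · exact H
    · intro h; apply hj1; linear_combination h - Hi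
    · intro h; apply hj2; linear_combination h - Hi
  by_cases ch : ∃ j, 1 ≤ j ∧ j < i ∧ Halts n k ℓ j
  swap
  · exfalso
    refine all_steps k hk P i hi1 (fun j => ℓ 0 (j : ZMod n) + c) hne hf h1 hl hr ?_ ?_ ?_
    all_goals
      have H : ∀ j, 1 ≤ j → j ≤ i → ℓ 0 (j : ZMod n) + c = (j : ZMod k) - 1 := by
        intro j hj
        induction j, hj using Nat.le_induction with
        | base => intro _; rw [h1]; simp
        | succ j hj ih =>
          intro hji
          rcases hno j hj (by omega) with h | h
          · exact absurd ⟨j, hj, by omega, h⟩ ch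
          · unfold Steps at h
            rw [h]
            push_cast
            linear_combination ih (by omega)
      have Hi := H i hi1 le_rfl
    · exact H
    · intro h; apply hj1; linear_combination h - Hi
    · intro h; apply hj2; linear_combination h - Hi
  by_contra hcon
  rw [not_or] at hcon
  obtain ⟨hc1, hc2⟩ := hcon
  classical
  have hS : ((Finset.Ico 1 i).filter (Steps n k ℓ)).card < k - 1 := by
    by_contra hge
    refine hc1 ⟨ch, _, not_lt.1 hge, ?_⟩
    intro j hj
    simpa [and_assoc] using hj
  have hH : ((Finset.Ico 1 i).filter (Halts n k ℓ)).card < k - 1 := by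
    by_contra hge
    refine hc2 ⟨cs, _, not_lt.1 hge, ?_⟩
    intro j hj
    simpa [and_assoc] using hj
  refine few_both k hk P i hi1 (fun j => ℓ 0 (j : ZMod n) + c) hne hf h1 hl hr
    (fun j => ((Finset.Ico 1 j).filter (Steps n k ℓ)).card)
    (fun j => ((Finset.Ico 1 j).filter (Halts n k ℓ)).card) (by simp) (by simp) ?_ ?_ ?_ ?_ ?_
  · intro j hj hji
    have hIco : Finset.Ico 1 (j + 1) = insert j (Finset.Ico 1 j) := by
      ext x; simp; omega
    have hnm : ∀ p : ℕ → Prop, j ∉ (Finset.Ico 1 j).filter p := by intro p; simp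
    simp only [hIco, Finset.filter_insert]
    rcases hno j hj hji with h | h
    · left
      have h' : ¬ Steps n k ℓ j := by
        unfold Steps Halts at *
        rw [h]; simp
      rw [if_pos h, if_neg h', Finset.card_insert_of_notMem (hnm _)]
      unfold Halts at h
      exact ⟨by rw [h], rfl, rfl⟩
    · right
      have h' : ¬ Halts n k ℓ j := by
        unfold Steps Halts at *
        rw [h]; simp
      rw [if_pos h, if_neg h', Finset.card_insert_of_notMem (hnm _)]
      unfold Steps at h
      exact ⟨by rw [h]; ring, rfl, rfl⟩
  · intro j hj hji
    have := Finset.card_le_card (Finset.filter_subset_filter (Steps n k ℓ)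
      (Finset.Ico_subset_Ico_right (a := 1) hji))
    show Finset.card _ + 2 ≤ k
    omega
  · intro j hj hji
    have := Finset.card_le_card (Finset.filter_subset_filter (Halts n k ℓ)
      (Finset.Ico_subset_Ico_right (a := 1) hji))
    show Finset.card _ + 2 ≤ k
    omega
  · intro h; apply hj1; linear_combination h
  · intro h; apply hj2; linear_combination h
end
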